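/- For every integer k ≥ 3, the number α_k (the unique root in (1,2) of x^{k+4} = x^{k+3} + x^{k+2} + x^k − x² − 1) belongs to B_{ℵ₀}; that is, there exists x ∈ (0, 1/(α_k − 1)) whose set of α_k-expansions is countably infinite. -/

import Mathlib

noncomputable section

open Set

/-- The map `T_{q,i}(x) = q*x - i` for a binary digit `i`. -/
def Tmap (q : ℝ) (i : Fin 2) (x : ℝ) : ℝ := q * x - ((i : ℕ) : ℝ)

/-- The value `((ε_i)_{i=1}^∞)_q = ∑_{i=1}^∞ ε_i q^{-i}` of a binary sequence in base `q`
(the sequence is 0-indexed, so digit `ε i` has weight `q^{-(i+1)}`). -/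
def seqVal (q : ℝ) (ε : ℕ → Fin 2) : ℝ := ∑' i : ℕ, ((ε i : ℕ) : ℝ) / q ^ (i + 1)

/-- `Σ_q(x)`: the set of `q`-expansions of `x`. -/
def SigmaSet (q x : ℝ) : Set (ℕ → Fin 2) := {ε | x = seqVal q ε}

/-- The interval `I_q = [0, 1/(q-1)]`. -/
def Iq (q : ℝ) : Set ℝ := Icc 0 (1 / (q - 1))

/-- The switch region `S_q = [1/q, 1/(q(q-1))]`. -/
def Sq (q : ℝ) : Set ℝ := Icc (1 / q) (1 / (q * (q - 1)))

/-- The interval `J_q = [(q+q²)/(q⁴-1), (1+q³)/(q⁴-1)]`. -/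
def Jq (q : ℝ) : Set ℝ := Icc ((q + q ^ 2) / (q ^ 4 - 1)) ((1 + q ^ 3) / (q ^ 4 - 1))

/-- Apply the first `n` maps of a sequence of maps to `x`:
`applySeq a n x = (a_{n-1} ∘ ⋯ ∘ a_0)(x)`. -/
def applySeq (a : ℕ → ℝ → ℝ) (n : ℕ) (x : ℝ) : ℝ := (List.range n).foldl (fun y k => a k y) x

/-- `Ω_q(x)`: the set of sequences of maps, each equal to `T_{q,0}` or `T_{q,1}`,
all of whose partial compositions applied to `x` stay in `I_q`. -/
def OmegaSet (q x : ℝ) : Set (ℕ → ℝ → ℝ) :=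
  {a | (∀ n, a n = Tmap q 0 ∨ a n = Tmap q 1) ∧ ∀ n : ℕ, applySeq a (n + 1) x ∈ Iq q}

/-- Apply a finite word of digits to `x` (first letter applied first):
for `a = [a₁, …, aₙ]`, `wordMap q a x = (T_{q,aₙ} ∘ ⋯ ∘ T_{q,a₁})(x)`. -/
def wordMap (q : ℝ) (a : List (Fin 2)) (x : ℝ) : ℝ := a.foldl (fun y i => Tmap q i y) x

/-- A branching sequence for `x`: a finite word whose partial compositions applied to `x`
stay in `I_q`, and whose full composition maps `x` into the switch region `S_q`. -/
def IsBranching (q x : ℝ) (a : List (Fin 2)) : Prop :=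
  (∀ k, k ≤ a.length → wordMap q (a.take k) x ∈ Iq q) ∧ wordMap q a x ∈ Sq q

/-- `x` is a `q` null infinite point: `x ∈ (0,1/(q-1))`, `Ω_q(x)` is infinite, and for every
branching sequence `a` for `x` there is a digit `i` with `Ω_q(T_{q,i}(a(x)))` finite. -/
def NullInfinite (q x : ℝ) : Prop :=
  x ∈ Ioo 0 (1 / (q - 1)) ∧ (OmegaSet q x).Infinite ∧
    ∀ a : List (Fin 2), IsBranching q x a →
      ∃ i : Fin 2, (OmegaSet q (Tmap q i (wordMap q a x))).Finite

/-- `U_q`: points of `I_q` with exactly one `q`-expansion. -/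
def UniqSet (q : ℝ) : Set ℝ := {x | x ∈ Iq q ∧ ∃! ε : ℕ → Fin 2, ε ∈ SigmaSet q x}

/-- `B_{ℵ₀}`: bases `q ∈ (1,2)` for which some `x ∈ (0,1/(q-1))` has exactly countably
infinitely many `q`-expansions. -/
def BAleph0 : Set ℝ :=
  {q | q ∈ Ioo (1 : ℝ) 2 ∧ ∃ x ∈ Ioo (0 : ℝ) (1 / (q - 1)),
    Cardinal.mk ↥(SigmaSet q x) = Cardinal.aleph0}

/-- The eventually periodic binary sequence `u w^∞`: the finite word `u` followed by
infinitely many repetitions of the finite word `w`. -/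
def uwInf (u w : List (Fin 2)) : ℕ → Fin 2 := fun i =>
  if i < u.length then u.getD i 0 else w.getD ((i - u.length) % w.length) 0

/-- Drop the first digit of a binary sequence. -/
def seqTail (ε : ℕ → Fin 2) : ℕ → Fin 2 := fun n => ε (n + 1)

/-- Prepend a digit to a binary sequence. -/
def seqCons (d : Fin 2) (ε : ℕ → Fin 2) : ℕ → Fin 2
  | 0 => d
  | n + 1 => ε n

lemma seqTail_seqCons (d : Fin 2) (ε : ℕ → Fin 2) : seqTail (seqCons d ε) = ε := rfl

lemma seqCons_seqTail (ε : ℕ → Fin 2) : seqCons (ε 0) (seqTail ε) = ε := by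
  funext n
  cases n <;> rfl

lemma seqCons_injective (d : Fin 2) : Function.Injective (seqCons d) := fun ε δ h => by
  rw [← seqTail_seqCons d ε, h, seqTail_seqCons]

lemma seqTail_iterate_apply (ε : ℕ → Fin 2) (n i : ℕ) : seqTail^[n] ε i = ε (n + i) := by
  induction n generalizing i with
  | zero => simp
  | succ n ih =>
    rw [Function.iterate_succ_apply']
    change seqTail^[n] ε (i + 1) = _
    rw [ih]
    congr 1
    omega

lemma countable_preimage_seqTail_iterate {A : Set (ℕ → Fin 2)} (hA : A.Countable) (n : ℕ) :
    (seqTail^[n] ⁻¹' A).Countable := by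
  induction n with
  | zero => simpa using hA
  | succ n ih =>
    refine (countable_iUnion fun d : Fin 2 => ih.image (seqCons d)).mono fun ε hε => ?_
    exact mem_iUnion.2 ⟨ε 0, seqTail ε, hε, seqCons_seqTail ε⟩

section Expansions

variable {q : ℝ}

lemma digit_nonneg (d : Fin 2) : (0 : ℝ) ≤ ((d : ℕ) : ℝ) := Nat.cast_nonneg _

lemma digit_le_one (d : Fin 2) : ((d : ℕ) : ℝ) ≤ 1 := by
  exact_mod_cast Nat.le_of_lt_succ d.isLt

lemma hasSum_inv_pow_succ (hq : 1 < q) : HasSum (fun i : ℕ => 1 / q ^ (i + 1)) (1 / (q - 1)) := by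
  have h := (hasSum_geometric_of_lt_one (inv_nonneg.2 (by linarith))
    (inv_lt_one_of_one_lt₀ hq)).mul_left q⁻¹
  have h0 : q ≠ 0 := by linarith
  have h2 : q⁻¹ * (1 - q⁻¹)⁻¹ = 1 / (q - 1) := by
    rw [← mul_inv, mul_sub, mul_inv_cancel₀ h0, mul_one, one_div]
  rw [h2] at h
  simpa only [pow_succ, inv_pow, one_div, mul_inv, mul_comm] using h

lemma digit_div_pow_le (hq : 1 < q) (ε : ℕ → Fin 2) (i : ℕ) :
    ((ε i : ℕ) : ℝ) / q ^ (i + 1) ≤ 1 / q ^ (i + 1) := by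
  have : 0 < q := by linarith
  have := digit_le_one (ε i)
  gcongr

lemma digit_div_pow_nonneg (hq : 1 < q) (ε : ℕ → Fin 2) (i : ℕ) :
    0 ≤ ((ε i : ℕ) : ℝ) / q ^ (i + 1) := by
  have : 0 < q := by linarith
  positivity

lemma summable_digits (hq : 1 < q) (ε : ℕ → Fin 2) :
    Summable fun i : ℕ => ((ε i : ℕ) : ℝ) / q ^ (i + 1) :=
  Summable.of_nonneg_of_le (digit_div_pow_nonneg hq ε) (digit_div_pow_le hq ε)
    (hasSum_inv_pow_succ hq).summable

lemma mul_seqVal (hq : 1 < q) (ε : ℕ → Fin 2) :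
    q * seqVal q ε = ((ε 0 : ℕ) : ℝ) + seqVal q (seqTail ε) := by
  have h0 : q ≠ 0 := by linarith
  unfold seqVal
  rw [(summable_digits hq ε).tsum_eq_zero_add, mul_add, ← tsum_mul_left]
  congr 1
  · rw [zero_add, pow_one]
    field_simp
  · refine tsum_congr fun i => ?_
    rw [pow_succ q (i + 1), seqTail]
    field_simp

lemma mem_SigmaSet_iff (hq : 1 < q) {x : ℝ} {ε : ℕ → Fin 2} :
    ε ∈ SigmaSet q x ↔ seqTail ε ∈ SigmaSet q (Tmap q (ε 0) x) := by
  have h0 : 0 < q := by linarith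
  have h := mul_seqVal hq ε
  simp only [SigmaSet, mem_ofPred_eq, Tmap]
  constructor
  · rintro rfl
    linarith
  · intro h'
    exact mul_left_cancel₀ h0.ne' (by linarith)

lemma seqCons_mem_SigmaSet (hq : 1 < q) {x : ℝ} {d : Fin 2} {ε : ℕ → Fin 2}
    (h : ε ∈ SigmaSet q (Tmap q d x)) : seqCons d ε ∈ SigmaSet q x :=
  (mem_SigmaSet_iff hq).2 h

lemma mem_Iq_of_mem_SigmaSet (hq : 1 < q) {x : ℝ} {ε : ℕ → Fin 2} (h : ε ∈ SigmaSet q x) :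
    x ∈ Iq q := by
  obtain rfl : x = seqVal q ε := h
  exact ⟨tsum_nonneg (digit_div_pow_nonneg hq ε),
    ((summable_digits hq ε).tsum_le_tsum (digit_div_pow_le hq ε)
      (hasSum_inv_pow_succ hq).summable).trans_eq (hasSum_inv_pow_succ hq).tsum_eq⟩

lemma SigmaSet_countable_of_notMem_Iq (hq : 1 < q) {x : ℝ} (h : x ∉ Iq q) :
    (SigmaSet q x).Countable := by
  have : SigmaSet q x = ∅ := eq_empty_of_forall_notMem fun ε hε => h (mem_Iq_of_mem_SigmaSet hq hε)
  simp [this]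

/-- If from each point of `F` one digit leads back into `F` and the other leads to a point with
countably many expansions, then the points of `F` have countably many expansions. -/
lemma SigmaSet_countable_of_branching (hq : 1 < q) {F : Set ℝ}
    (hF : ∀ x ∈ F, ∃ d : Fin 2, Tmap q d x ∈ F ∧
      ∀ e : Fin 2, e ≠ d → (SigmaSet q (Tmap q e x)).Countable)
    {x : ℝ} (hx : x ∈ F) : (SigmaSet q x).Countable := by
  choose! d hdF hd using hF
  let o : ℕ → ℝ := fun n => (fun y => Tmap q (d y) y)^[n] x
  have ho : ∀ n, o (n + 1) = Tmap q (d (o n)) (o n) := fun n =>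
    Function.iterate_succ_apply' _ _ _
  have hoF : ∀ n, o n ∈ F := fun n => by
    induction n with
    | zero => exact hx
    | succ n ih => rw [ho]; exact hdF _ ih
  let A : ℕ → Set (ℕ → Fin 2) := fun n =>
    ⋃ e : Fin 2, ⋃ _ : e ≠ d (o n), SigmaSet q (Tmap q e (o n))
  have hA : ∀ n, (A n).Countable := fun n =>
    countable_iUnion fun e => countable_iUnion fun he => hd _ (hoF n) e he
  refine ((countable_singleton fun n => d (o n)).union (countable_iUnion fun n =>
    countable_preimage_seqTail_iterate (hA n) (n + 1))).mono fun ε hε => ?_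
  by_cases hall : ∀ n, ε n = d (o n)
  · exact Or.inl (funext hall)
  right
  push Not at hall
  classical
  have key : ∀ n, (∀ i < n, ε i = d (o i)) → seqTail^[n] ε ∈ SigmaSet q (o n) := fun n => by
    induction n with
    | zero => exact fun _ => hε
    | succ n ih =>
      intro h
      have h1 := (mem_SigmaSet_iff hq).1 (ih fun i hi => h i (by omega))
      rw [Function.iterate_succ_apply', ho, ← h n (by omega)]
      simpa [seqTail_iterate_apply] using h1
  have hmem := (mem_SigmaSet_iff hq).1
    (key (Nat.find hall) fun i hi => not_not.1 (Nat.find_min hall hi))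
  have hne := Nat.find_spec hall
  rw [seqTail_iterate_apply, add_zero, ← Function.iterate_succ_apply' seqTail] at hmem
  exact mem_iUnion.2 ⟨Nat.find hall, mem_iUnion₂.2 ⟨_, hne, hmem⟩⟩

/-- Points of a bounded set from which some digit leads back into the set have an expansion. -/
lemma SigmaSet_nonempty_of_invariant (hq : 1 < q) {F : Set ℝ} (hFI : F ⊆ Iq q)
    (hF : ∀ x ∈ F, ∃ d : Fin 2, Tmap q d x ∈ F) {x : ℝ} (hx : x ∈ F) :
    (SigmaSet q x).Nonempty := by
  have h0 : 0 < q := by linarith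
  choose! d hdF using hF
  let o : ℕ → ℝ := fun n => (fun y => Tmap q (d y) y)^[n] x
  have ho : ∀ n, o (n + 1) = Tmap q (d (o n)) (o n) := fun n =>
    Function.iterate_succ_apply' _ _ _
  have hoF : ∀ n, o n ∈ F := fun n => by
    induction n with
    | zero => exact hx
    | succ n ih => rw [ho]; exact hdF _ ih
  have hsum : ∀ n, ∑ i ∈ Finset.range n, ((d (o i) : ℕ) : ℝ) / q ^ (i + 1) =
      x - o n * (q⁻¹) ^ n := fun n => by
    induction n with
    | zero => simp [o]
    | succ n ih =>
      rw [Finset.sum_range_succ, ih, ho, Tmap, inv_pow, inv_pow, pow_succ]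
      field_simp
      ring
  have hlim : Filter.Tendsto (fun n => o n * (q⁻¹) ^ n) Filter.atTop (nhds 0) := by
    have hg := (tendsto_pow_atTop_nhds_zero_of_lt_one (inv_nonneg.2 h0.le)
      (inv_lt_one_of_one_lt₀ hq)).const_mul (1 / (q - 1))
    rw [mul_zero] at hg
    refine squeeze_zero (fun n => ?_) (fun n => ?_) hg
    · have := (hFI (hoF n)).1
      positivity
    · have := (hFI (hoF n)).2
      gcongr
  refine ⟨fun n => d (o n), ?_⟩
  have h1 := (summable_digits hq fun n => d (o n)).hasSum.tendsto_sum_nat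
  simp only [hsum] at h1
  have h2 := hlim.const_sub x
  rw [sub_zero] at h2
  exact tendsto_nhds_unique h2 h1

/-- The values of `0^m (10)^∞` and `1^m (01)^∞` for `m ≥ 0`. -/
def alternatingTails (q : ℝ) : Set ℝ :=
  {x | ∃ m : ℕ, x = q / (q ^ 2 - 1) / q ^ m ∨ x = 1 / (q - 1) - q / (q ^ 2 - 1) / q ^ m}

lemma alternatingTails_step (hq : 1 < q) (hG : q + 1 < q ^ 2) {x : ℝ}
    (hx : x ∈ alternatingTails q) :
    ∃ d : Fin 2, Tmap q d x ∈ alternatingTails q ∧ ∀ e : Fin 2, e ≠ d → Tmap q e x ∉ Iq q := by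
  have h1 : 0 < q - 1 := by linarith
  have h2 : 0 < q ^ 2 - 1 := by nlinarith
  have hs : q / (q ^ 2 - 1) < 1 := by rw [div_lt_one h2]; linarith
  have hs0 : 0 < q / (q ^ 2 - 1) := by positivity
  have hfix : q * (1 / (q - 1)) = 1 / (q - 1) + 1 := by field_simp; ring
  have hcompl : 1 / (q - 1) - q / (q ^ 2 - 1) = q * (q / (q ^ 2 - 1)) - 1 := by
    have : q ^ 2 - 1 = (q - 1) * (q + 1) := by ring
    rw [this]
    field_simp
    ring
  obtain ⟨m, rfl | rfl⟩ := hx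
  · cases m with
    | zero =>
      refine ⟨1, ⟨0, Or.inr ?_⟩, fun e he => ?_⟩
      · simpa [Tmap] using hcompl.symm
      · obtain rfl : e = 0 := by omega
        intro h
        have := h.2
        simp only [Tmap, Fin.val_zero, Nat.cast_zero, pow_zero, div_one] at this
        linarith
    | succ m =>
      have hm : q * (q / (q ^ 2 - 1) / q ^ (m + 1)) = q / (q ^ 2 - 1) / q ^ m := by
        field_simp; ring
      refine ⟨0, ⟨m, Or.inl ?_⟩, fun e he => ?_⟩
      · simpa [Tmap] using hm
      · obtain rfl : e = 1 := by omega
        intro h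
        have := h.1
        have hle := div_le_self hs0.le (one_le_pow₀ hq.le (n := m))
        simp only [Tmap, Fin.val_one, Nat.cast_one, hm] at this
        linarith
  · cases m with
    | zero =>
      refine ⟨0, ⟨0, Or.inl ?_⟩, fun e he => ?_⟩
      · simp only [Tmap, Fin.val_zero, Nat.cast_zero, pow_zero, div_one]
        have : q ^ 2 - 1 = (q - 1) * (q + 1) := by ring
        rw [this]
        field_simp
        ring
      · obtain rfl : e = 1 := by omega
        intro h
        have := h.1
        have hm : q * (1 / (q - 1) - q / (q ^ 2 - 1)) = q / (q ^ 2 - 1) := by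
          have : q ^ 2 - 1 = (q - 1) * (q + 1) := by ring
          rw [this]
          field_simp
          ring
        simp only [Tmap, Fin.val_one, Nat.cast_one, pow_zero, div_one, hm] at this
        linarith
    | succ m =>
      have hm : q * (1 / (q - 1) - q / (q ^ 2 - 1) / q ^ (m + 1)) =
          1 / (q - 1) + 1 - q / (q ^ 2 - 1) / q ^ m := by
        rw [mul_sub, hfix]; field_simp; ring
      refine ⟨1, ⟨m, Or.inr ?_⟩, fun e he => ?_⟩
      · simp only [Tmap, Fin.val_one, Nat.cast_one, hm]
        ring
      · obtain rfl : e = 0 := by omega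
        intro h
        have := h.2
        have hle := div_le_self hs0.le (one_le_pow₀ hq.le (n := m))
        simp only [Tmap, Fin.val_zero, Nat.cast_zero, hm] at this
        linarith

lemma alternatingTails_subset_Iq (hq : 1 < q) : alternatingTails q ⊆ Iq q := by
  have h1 : 0 < q - 1 := by linarith
  have h2 : 0 < q ^ 2 - 1 := by nlinarith
  have hle : q / (q ^ 2 - 1) ≤ 1 / (q - 1) := by
    rw [div_le_div_iff₀ h2 h1]; nlinarith
  have hs0 : 0 < q / (q ^ 2 - 1) := by positivity
  rintro x ⟨m, hx⟩
  have hm := div_le_self hs0.le (one_le_pow₀ hq.le (n := m))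
  have hm0 : 0 < q / (q ^ 2 - 1) / q ^ m := by positivity
  obtain rfl | rfl := hx <;> constructor <;> linarith

lemma SigmaSet_countable_of_mem_alternatingTails (hq : 1 < q) (hG : q + 1 < q ^ 2) {x : ℝ}
    (hx : x ∈ alternatingTails q) : (SigmaSet q x).Countable :=
  SigmaSet_countable_of_branching hq (fun _ hy =>
    let ⟨d, hd, he⟩ := alternatingTails_step hq hG hy
    ⟨d, hd, fun e h => SigmaSet_countable_of_notMem_Iq hq (he e h)⟩) hx

lemma SigmaSet_nonempty_of_mem_alternatingTails (hq : 1 < q) (hG : q + 1 < q ^ 2) {x : ℝ}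
    (hx : x ∈ alternatingTails q) : (SigmaSet q x).Nonempty :=
  SigmaSet_nonempty_of_invariant hq (alternatingTails_subset_Iq hq) (fun _ hy =>
    let ⟨d, hd, _⟩ := alternatingTails_step hq hG hy
    ⟨d, hd⟩) hx

/-- If `(1001)^∞` can be continued after the digit `0` by an alternating tail, then its value has
countably infinitely many expansions. -/
lemma mk_SigmaSet_eq_aleph0 (hq : 1 < q) (hG : q + 1 < q ^ 2) {m : ℕ}
    (hm : q * ((q ^ 3 + 1) / (q ^ 4 - 1)) = 1 / (q - 1) - q / (q ^ 2 - 1) / q ^ m) :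
    Cardinal.mk ↥(SigmaSet q ((q ^ 3 + 1) / (q ^ 4 - 1))) = Cardinal.aleph0 := by
  have h0 : 0 < q := by linarith
  have h1 : 0 < q - 1 := by linarith
  have h4' : q ^ 4 - 1 = (q - 1) * (q ^ 3 + q ^ 2 + q + 1) := by ring
  have h4 : 0 < q ^ 4 - 1 := by rw [h4']; positivity
  have hc : Tmap q 1 ((q ^ 3 + 1) / (q ^ 4 - 1)) = (q + 1) / (q ^ 4 - 1) := by
    simp only [Tmap, Fin.val_one, Nat.cast_one]; field_simp; ring
  have ha : Tmap q 0 ((q + 1) / (q ^ 4 - 1)) = (q ^ 2 + q) / (q ^ 4 - 1) := by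
    simp only [Tmap, Fin.val_zero, Nat.cast_zero]; field_simp; ring
  have hc' : Tmap q 0 ((q ^ 2 + q) / (q ^ 4 - 1)) = (q ^ 3 + q ^ 2) / (q ^ 4 - 1) := by
    simp only [Tmap, Fin.val_zero, Nat.cast_zero]; field_simp; ring
  have hb : Tmap q 1 ((q ^ 3 + q ^ 2) / (q ^ 4 - 1)) = (q ^ 3 + 1) / (q ^ 4 - 1) := by
    simp only [Tmap, Fin.val_one, Nat.cast_one]; field_simp; ring
  have hc0 : Tmap q 0 ((q ^ 3 + 1) / (q ^ 4 - 1)) ∈ alternatingTails q :=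
    ⟨m, Or.inr (by simpa [Tmap] using hm)⟩
  have hc'1 : Tmap q 1 ((q ^ 2 + q) / (q ^ 4 - 1)) ∈ alternatingTails q := by
    refine ⟨m, Or.inl ?_⟩
    have : q * ((q ^ 2 + q) / (q ^ 4 - 1)) - 1 =
        1 / (q - 1) - q * ((q ^ 3 + 1) / (q ^ 4 - 1)) := by
      rw [h4']; field_simp; ring
    simp only [Tmap, Fin.val_one, Nat.cast_one, this, hm]
    ring
  have hgap : q ^ 2 + q < q ^ 4 - 1 := by nlinarith
  have ha1 : Tmap q 1 ((q + 1) / (q ^ 4 - 1)) ∉ Iq q := fun h => by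
    have hn := h.1
    have : (q ^ 2 + q) / (q ^ 4 - 1) < 1 := (div_lt_one h4).2 hgap
    rw [← ha] at this
    simp only [Tmap, Fin.val_one, Nat.cast_one, Fin.val_zero, Nat.cast_zero] at hn this
    linarith
  have hb0 : Tmap q 0 ((q ^ 3 + q ^ 2) / (q ^ 4 - 1)) ∉ Iq q := fun h => by
    have hn := h.2
    have hlt : (q ^ 2 + q) / (q ^ 4 - 1) < 1 := (div_lt_one h4).2 hgap
    have : q * ((q ^ 3 + q ^ 2) / (q ^ 4 - 1)) =
        1 / (q - 1) + 1 - (q ^ 2 + q) / (q ^ 4 - 1) := by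
      rw [h4']; field_simp; ring
    simp only [Tmap, Fin.val_zero, Nat.cast_zero] at hn
    linarith
  have hcount : (SigmaSet q ((q ^ 3 + 1) / (q ^ 4 - 1))).Countable := by
    refine SigmaSet_countable_of_branching hq (F := {(q ^ 3 + 1) / (q ^ 4 - 1),
      (q + 1) / (q ^ 4 - 1), (q ^ 2 + q) / (q ^ 4 - 1), (q ^ 3 + q ^ 2) / (q ^ 4 - 1)}) ?_
      (by simp)
    rintro x (rfl | rfl | rfl | rfl)
    · refine ⟨1, by simp [hc], fun e he => ?_⟩
      obtain rfl : e = 0 := by omega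
      exact SigmaSet_countable_of_mem_alternatingTails hq hG hc0
    · refine ⟨0, by simp [ha], fun e he => ?_⟩
      obtain rfl : e = 1 := by omega
      exact SigmaSet_countable_of_notMem_Iq hq ha1
    · refine ⟨0, by simp [hc'], fun e he => ?_⟩
      obtain rfl : e = 1 := by omega
      exact SigmaSet_countable_of_mem_alternatingTails hq hG hc'1
    · refine ⟨1, by simp [hb], fun e he => ?_⟩
      obtain rfl : e = 0 := by omega
      exact SigmaSet_countable_of_notMem_Iq hq hb0
  have hinf : (SigmaSet q ((q ^ 3 + 1) / (q ^ 4 - 1))).Infinite := fun hfin => by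
    obtain ⟨δ, hδ⟩ := SigmaSet_nonempty_of_mem_alternatingTails hq hG hc0
    let f : (ℕ → Fin 2) → ℕ → Fin 2 := fun ε => seqCons 1 (seqCons 0 (seqCons 0 (seqCons 1 ε)))
    have hf : f.Injective := fun ε ε' h => seqCons_injective _ (seqCons_injective _
      (seqCons_injective _ (seqCons_injective _ h)))
    have hmaps : f '' SigmaSet q ((q ^ 3 + 1) / (q ^ 4 - 1)) ⊆
        SigmaSet q ((q ^ 3 + 1) / (q ^ 4 - 1)) := by
      rintro _ ⟨ε, hε, rfl⟩
      refine seqCons_mem_SigmaSet hq (seqCons_mem_SigmaSet hq (seqCons_mem_SigmaSet hq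
        (seqCons_mem_SigmaSet hq ?_)))
      rwa [hc, ha, hc', hb]
    have heq := eq_of_subset_of_ncard_le hmaps (ncard_image_of_injective _ hf).ge hfin
    have hmem := seqCons_mem_SigmaSet hq hδ
    rw [← heq] at hmem
    obtain ⟨ε, -, hε⟩ := hmem
    exact one_ne_zero (congrFun hε 0)
  have := hcount.to_subtype
  have := hinf.to_subtype
  exact Cardinal.mk_eq_aleph0 _

end Expansions

lemma add_one_lt_sq_of_root {k : ℕ} (hk : 3 ≤ k) {q : ℝ} (hq : 1 < q)
    (h : q ^ (k + 4) = q ^ (k + 3) + q ^ (k + 2) + q ^ k - q ^ 2 - 1) : q + 1 < q ^ 2 := by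
  by_contra! hG
  have h0 : 0 < q := by linarith
  have hpow : q ^ 3 ≤ q ^ k := pow_le_pow_right₀ hq.le hk
  have e3 : q ^ 3 ≤ q ^ 2 + q := by nlinarith
  have e4 : q ^ 4 ≤ q ^ 3 + q ^ 2 := by nlinarith [mul_le_mul_of_nonneg_left hG (sq_nonneg q)]
  have e5 : q ^ 5 ≤ q ^ 4 + q ^ 3 := by nlinarith [mul_le_mul_of_nonneg_left hG (pow_pos h0 3).le]
  have e6 : q ^ 6 ≤ q ^ 5 + q ^ 4 := by nlinarith [mul_le_mul_of_nonneg_left hG (pow_pos h0 4).le]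
  have hP : q ^ k * (q ^ 3 + q ^ 2 + 1 - q ^ 4) = q ^ 2 + 1 := by
    have : q ^ k * (q ^ 3 + q ^ 2 + 1 - q ^ 4) = q ^ (k + 3) + q ^ (k + 2) + q ^ k - q ^ (k + 4) := by
      ring
    rw [this, h]; ring
  have hle : q ^ 3 * (q ^ 3 + q ^ 2 + 1 - q ^ 4) ≤ q ^ 2 + 1 :=
    (mul_le_mul_of_nonneg_right hpow (by linarith)).trans hP.le
  have hneg : q ^ 6 - q ^ 4 - q ^ 3 - 2 * q ^ 2 - q - 1 < 0 := by linarith [sq_nonneg q]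
  nlinarith [mul_neg_of_pos_of_neg (sub_pos.2 hq) hneg]

/-- For every `k ≥ 3`, `α_k` (the unique root in `(1,2)` of
`x^{k+4} = x^{k+3} + x^{k+2} + x^k − x² − 1`) belongs to `B_{ℵ₀}`. -/
theorem alpha_k_mem_BAleph0
    (k : ℕ) (hk : 3 ≤ k) (α : ℝ) (hα1 : α ∈ Set.Ioo (1 : ℝ) 2)
    (hα2 : α ^ (k + 4) = α ^ (k + 3) + α ^ (k + 2) + α ^ k - α ^ 2 - 1) :
    α ∈ BAleph0 := by
  obtain ⟨h1, h2⟩ := hα1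
  have hG := add_one_lt_sq_of_root hk h1 hα2
  have h0 : 0 < α := by linarith
  have h1' : 0 < α - 1 := by linarith
  have hfac : α ^ 4 - 1 = (α - 1) * (α + 1) * (α ^ 2 + 1) := by ring
  have hfac' : α ^ 2 - 1 = (α - 1) * (α + 1) := by ring
  have h4 : 0 < α ^ 4 - 1 := by rw [hfac]; positivity
  refine ⟨⟨h1, h2⟩, (α ^ 3 + 1) / (α ^ 4 - 1), ⟨by positivity, ?_⟩,
    mk_SigmaSet_eq_aleph0 h1 hG (m := k + 1) ?_⟩
  · rw [div_lt_div_iff₀ h4 h1']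
    nlinarith [mul_pos h1' h0, mul_pos h1' (pow_pos h0 2)]
  · have hP : α ^ k * α ^ 4 = α ^ k * α ^ 3 + α ^ k * α ^ 2 + α ^ k - α ^ 2 - 1 := by
      rw [← pow_add, ← pow_add, ← pow_add, hα2]
    rw [hfac, hfac', pow_succ]
    field_simp
    linear_combination α * hP
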